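/- Let Ω ⊆ ℝⁿ be open and let Γ^i_{jk}, c^i_{jk} : Ω → ℝ (i,j,k ∈ {1,…,n}) be smooth functions, both symmetric in the lower indices (Γ^i_{jk} = Γ^i_{kj}, c^i_{jk} = c^i_{kj}). For λ ∈ ℝ set Γ^{(λ)i}_{jk} := Γ^i_{jk} − λ c^i_{jk}, and define its curvature R^{(λ)k}_{ijl} := ∂_i Γ^{(λ)k}_{jl} − ∂_j Γ^{(λ)k}_{il} + Σ_m ( Γ^{(λ)k}_{im} Γ^{(λ)m}_{jl} − Γ^{(λ)k}_{jm} Γ^{(λ)m}_{il} ). Define the covariant derivative ∇_i c^k_{jl} := ∂_i c^k_{jl} + Σ_m ( Γ^k_{im} c^m_{jl} − Γ^m_{ij} c^k_{ml} − Γ^m_{il} c^k_{jm} ). Then R^{(λ)} = R^{(0)} identically on Ω for every λ ∈ ℝ if and only if, for all indices i,j,k,l and all points of Ω, ∇_i c^k_{jl} = ∇_j c^k_{il} (symmetry of ∇c in the lower indices) and Σ_m c^k_{im} c^m_{jl} = Σ_m c^k_{jm} c^m_{il} (associativity of the product with structure functions c). -/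

import Mathlib

/-- Partial derivative of a scalar function on `ℝⁿ` in the `i`-th coordinate direction. -/
noncomputable def pd {n : ℕ} (f : (Fin n → ℝ) → ℝ) (i : Fin n) (p : Fin n → ℝ) : ℝ :=
  fderiv ℝ f p (Pi.single i 1)

theorem pd_sub_const_mul {n : ℕ} {f g : (Fin n → ℝ) → ℝ} {p : Fin n → ℝ}
    (hf : DifferentiableAt ℝ f p) (hg : DifferentiableAt ℝ g p) (a : ℝ) (i : Fin n) :
    pd (fun q => f q - a * g q) i p = pd f i p - a * pd g i p := by
  have h : HasFDerivAt (fun q => f q - a * g q) (fderiv ℝ f p - a • fderiv ℝ g p) p :=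
    hf.hasFDerivAt.sub (hg.hasFDerivAt.const_mul a)
  simp [pd, h.fderiv]

/-- A quadratic polynomial function without constant term vanishes iff its coefficients do. -/
theorem forall_neg_mul_add_sq_mul_eq_zero_iff (D A : ℝ) :
    (∀ a : ℝ, -a * D + a ^ 2 * A = 0) ↔ D = 0 ∧ A = 0 := by
  refine ⟨fun h => ?_, fun ⟨hD, hA⟩ a => by simp [hD, hA]⟩
  have h1 := h 1
  have h2 := h (-1)
  constructor <;> linarith

/-- the curvature of the one-parameter family of connections
`Γ^{(λ)i}_{jk} = Γ^i_{jk} − λ c^i_{jk}` is independent of `λ` on `Ω` if and only if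
`∇c` is symmetric in its lower indices and the product with structure functions `c`
is associative. -/
theorem lambda_independent_curvature_iff
    (n : ℕ) (Ω : Set (Fin n → ℝ)) (hΩ : IsOpen Ω)
    (Γ c : Fin n → Fin n → Fin n → (Fin n → ℝ) → ℝ)
    (hΓsmooth : ∀ i j k, ContDiffOn ℝ (⊤ : ℕ∞) (Γ i j k) Ω)
    (hcsmooth : ∀ i j k, ContDiffOn ℝ (⊤ : ℕ∞) (c i j k) Ω)
    (hΓsym : ∀ i j k, ∀ p ∈ Ω, Γ i j k p = Γ i k j p)
    (hcsym : ∀ i j k, ∀ p ∈ Ω, c i j k p = c i k j p)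
    -- the deformed Christoffel symbols Γ^{(λ)i}_{jk}
    (Γl : ℝ → Fin n → Fin n → Fin n → (Fin n → ℝ) → ℝ)
    (hΓl : ∀ lam i j k p, Γl lam i j k p = Γ i j k p - lam * c i j k p)
    -- the curvature R^{(λ)k}_{ijl}
    (Rl : ℝ → Fin n → Fin n → Fin n → Fin n → (Fin n → ℝ) → ℝ)
    (hRl : ∀ lam k i j l p, Rl lam k i j l p =
      pd (Γl lam k j l) i p - pd (Γl lam k i l) j p
        + ∑ m, (Γl lam k i m p * Γl lam m j l p - Γl lam k j m p * Γl lam m i l p))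
    -- the covariant derivative ∇_i c^k_{jl}
    (nc : Fin n → Fin n → Fin n → Fin n → (Fin n → ℝ) → ℝ)
    (hnc : ∀ i k j l p, nc i k j l p = pd (c k j l) i p
      + ∑ m, (Γ k i m p * c m j l p - Γ m i j p * c k m l p - Γ m i l p * c k j m p)) :
    (∀ lam : ℝ, ∀ p ∈ Ω, ∀ k i j l, Rl lam k i j l p = Rl 0 k i j l p) ↔
      (∀ p ∈ Ω, ∀ i j k l,
        nc i k j l p = nc j k i l p ∧
          ∑ m, c k i m p * c m j l p = ∑ m, c k j m p * c m i l p) := by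
  have hdiff : ∀ {f : (Fin n → ℝ) → ℝ}, ContDiffOn ℝ (⊤ : ℕ∞) f Ω → ∀ p ∈ Ω,
      DifferentiableAt ℝ f p := fun hf p hp =>
    (hf.contDiffAt (hΩ.mem_nhds hp)).differentiableAt (by simp)
  have hpd : ∀ lam i j k l, ∀ p ∈ Ω,
      pd (Γl lam k j l) i p = pd (Γ k j l) i p - lam * pd (c k j l) i p := by
    intro lam i j k l p hp
    rw [funext (hΓl lam k j l)]
    exact pd_sub_const_mul (hdiff (hΓsmooth k j l) p hp) (hdiff (hcsmooth k j l) p hp) lam i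
  have key : ∀ lam, ∀ p ∈ Ω, ∀ k i j l, Rl lam k i j l p - Rl 0 k i j l p =
      -lam * (nc i k j l p - nc j k i l p) +
        lam ^ 2 * (∑ m, c k i m p * c m j l p - ∑ m, c k j m p * c m i l p) := by
    intro lam p hp k i j l
    have hsum : ∑ m, (Γl lam k i m p * Γl lam m j l p - Γl lam k j m p * Γl lam m i l p)
        - ∑ m, (Γl 0 k i m p * Γl 0 m j l p - Γl 0 k j m p * Γl 0 m i l p) =
        -lam * (∑ m, (Γ k i m p * c m j l p - Γ m i j p * c k m l p - Γ m i l p * c k j m p)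
          - ∑ m, (Γ k j m p * c m i l p - Γ m j i p * c k m l p - Γ m j l p * c k i m p)) +
        lam ^ 2 * (∑ m, c k i m p * c m j l p - ∑ m, c k j m p * c m i l p) := by
      simp only [← Finset.sum_sub_distrib, Finset.mul_sum, ← Finset.sum_add_distrib]
      refine Finset.sum_congr rfl fun m _ => ?_
      rw [hΓsym m j i p hp]
      simp only [hΓl]
      ring
    rw [hRl, hRl, hnc, hnc, hpd _ _ _ _ _ p hp, hpd _ _ _ _ _ p hp, hpd _ _ _ _ _ p hp,
      hpd _ _ _ _ _ p hp]
    linear_combination hsum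
  have hiff : ∀ p ∈ Ω, ∀ k i j l, (∀ lam, Rl lam k i j l p = Rl 0 k i j l p) ↔
      nc i k j l p = nc j k i l p ∧
        ∑ m, c k i m p * c m j l p = ∑ m, c k j m p * c m i l p := by
    intro p hp k i j l
    rw [← sub_eq_zero (a := nc i k j l p),
      ← sub_eq_zero (a := ∑ m, c k i m p * c m j l p),
      ← forall_neg_mul_add_sq_mul_eq_zero_iff]
    exact forall_congr' fun lam => by rw [← key lam p hp, sub_eq_zero]
  exact ⟨fun h p hp i j k l => (hiff p hp k i j l).1 fun lam => h lam p hp k i j l,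
    fun h lam p hp k i j l => (hiff p hp k i j l).2 (h p hp i j k l) lam⟩
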